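/- For the unit disk, the zero-index (ñ = 0) conductive interior transmission eigenvalue problem with constant n > 0 and η > 0 has eigenvalue k > 0 if and only if for some integer m ≥ 0 one has det [[J_m(k√n), −1], [k√n J_m'(k√n) − η J_m(k√n), −m]] = 0, i.e., −m J_m(k√n) + k√n J_m'(k√n) − η J_m(k√n) = 0. -/

import Mathlib

open MeasureTheory Filter Topology
open scoped RealInnerProductSpace

noncomputable section

/-- Componentwise Laplacian via iterated Fréchet derivatives. -/
noncomputable def lap {d : ℕ} {F : Type*} [NormedAddCommGroup F] [NormedSpace ℝ F]
    (u : EuclideanSpace ℝ (Fin d) → F) (x : EuclideanSpace ℝ (Fin d)) : F :=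
  ∑ i, fderiv ℝ (fun y => fderiv ℝ u y (EuclideanSpace.single i 1)) x (EuclideanSpace.single i 1)

/-- Partial derivative in direction `i`. -/
noncomputable def pd {d : ℕ} {F : Type*} [NormedAddCommGroup F] [NormedSpace ℝ F]
    (i : Fin d) (u : EuclideanSpace ℝ (Fin d) → F) (x : EuclideanSpace ℝ (Fin d)) : F :=
  fderiv ℝ u x (EuclideanSpace.single i 1)

/-- Normal derivative with respect to the (outward unit normal) field `ν`. -/
noncomputable def nder {d : ℕ} {F : Type*} [NormedAddCommGroup F] [NormedSpace ℝ F]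
    (ν : EuclideanSpace ℝ (Fin d) → EuclideanSpace ℝ (Fin d))
    (u : EuclideanSpace ℝ (Fin d) → F) (x : EuclideanSpace ℝ (Fin d)) : F :=
  ∑ i, ν x i • pd i u x

/-- Stand-in for `X(D) = H²(D) ∩ H¹₀(D)`: twice differentiable functions vanishing on `∂D`. -/
def XD {d : ℕ} (D : Set (EuclideanSpace ℝ (Fin d))) (F : Type*) [NormedAddCommGroup F]
    [NormedSpace ℝ F] : Set (EuclideanSpace ℝ (Fin d) → F) :=
  {φ | ContDiff ℝ 2 φ ∧ ∀ x ∈ frontier D, φ x = 0}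
/-- The Bessel function of the first kind of integer order `m`, via its power series. -/
noncomputable def besselJ (m : ℕ) (x : ℝ) : ℝ :=
  ∑' j : ℕ, ((-1 : ℝ) ^ j / (j.factorial * (j + m).factorial)) * (x / 2) ^ (2 * j + m)

/-- The entire function `G_m(t) = ∑ (-1)^j / (j! (j+m)!) t^j`. -/
def besG (m : ℕ) (t : ℝ) : ℝ :=
  ∑' j : ℕ, ((-1 : ℝ) ^ j / (j.factorial * (j + m).factorial)) * t ^ j

lemma besG_coef_bound (m j : ℕ) (t : ℝ) :
    ‖((-1 : ℝ) ^ j / (j.factorial * (j + m).factorial)) * t ^ j‖ ≤ |t| ^ j / j.factorial := by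
  have h1 : (1:ℝ) ≤ (j+m).factorial := by exact_mod_cast Nat.one_le_iff_ne_zero.2 (Nat.factorial_ne_zero _)
  have h0 : (0:ℝ) < j.factorial := by exact_mod_cast Nat.factorial_pos _
  rw [norm_mul, norm_div, norm_pow, norm_neg, norm_one, one_pow, norm_pow, Real.norm_eq_abs,
    Real.norm_eq_abs, abs_of_pos (by positivity), div_mul_eq_mul_div, one_mul]
  gcongr
  nlinarith

lemma besG_summable (m : ℕ) (t : ℝ) :
    Summable fun j : ℕ => ((-1 : ℝ) ^ j / (j.factorial * (j + m).factorial)) * t ^ j :=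
  Summable.of_norm_bounded (Real.summable_pow_div_factorial |t|) fun j => besG_coef_bound m j t

lemma besG_succ_coef (m j : ℕ) (t : ℝ) :
    ((-1 : ℝ) ^ (j+1) / ((j+1).factorial * ((j+1) + m).factorial)) * (((j+1 : ℕ) : ℝ) * t ^ j)
      = - (((-1 : ℝ) ^ j / (j.factorial * (j + (m+1)).factorial)) * t ^ j) := by
  have h0 : (j.factorial : ℝ) ≠ 0 := by exact_mod_cast Nat.factorial_ne_zero _
  have h1 : ((j + (m+1)).factorial : ℝ) ≠ 0 := by exact_mod_cast Nat.factorial_ne_zero _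
  have h2 : (j:ℝ) + 1 ≠ 0 := by positivity
  rw [show j + 1 + m = j + (m+1) by ring, Nat.factorial_succ j]
  push_cast
  field_simp
  ring

lemma besG_hasDerivAt (m : ℕ) (t : ℝ) : HasDerivAt (besG m) (- besG (m+1) t) t := by
  set g' : ℕ → ℝ → ℝ := fun j y =>
    ((-1 : ℝ) ^ j / (j.factorial * (j + m).factorial)) * ((j : ℝ) * y ^ (j-1)) with hg'
  set R := |t| + 1 with hR
  have hR0 : 0 ≤ R := by positivity
  set u : ℕ → ℝ := fun j => (j : ℝ) * R ^ (j-1) / j.factorial with hu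
  have hus : Summable u := by
    rw [← summable_nat_add_iff 1]
    refine (Real.summable_pow_div_factorial R).congr fun j => ?_
    have h0 : (j.factorial : ℝ) ≠ 0 := by exact_mod_cast Nat.factorial_ne_zero _
    have h2 : (j:ℝ) + 1 ≠ 0 := by positivity
    simp only [hu, Nat.factorial_succ, Nat.add_sub_cancel]
    push_cast
    field_simp
  have key := hasDerivAt_tsum_of_isPreconnected (𝕜 := ℝ)
    (g := fun (j : ℕ) (y : ℝ) => ((-1 : ℝ) ^ j / (j.factorial * (j + m).factorial)) * y ^ j)
    (g' := g') (t := Metric.ball 0 R) (y₀ := t) (y := t) hus Metric.isOpen_ball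
    (convex_ball _ _).isPreconnected
    (fun j y _ => (hasDerivAt_pow j y).const_mul _) ?_ (by simp [hR]) (besG_summable m t)
    (by simp [hR])
  · have hs : Summable fun j => g' j t := by
      refine (summable_nat_add_iff 1).1 ?_
      refine ((besG_summable (m+1) t).neg).congr fun j => ?_
      simp only [hg', Nat.add_sub_cancel]
      exact (besG_succ_coef m j t).symm
    have : ∑' j, g' j t = - besG (m+1) t := by
      rw [hs.tsum_eq_zero_add, besG, ← tsum_neg]
      simp only [hg', Nat.add_sub_cancel, besG_succ_coef]
      simp
    rw [← this]
    exact key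
  · intro j y hy
    have h1 : (1:ℝ) ≤ (j+m).factorial := by
      exact_mod_cast Nat.one_le_iff_ne_zero.2 (Nat.factorial_ne_zero _)
    have h0 : (0:ℝ) < j.factorial := by exact_mod_cast Nat.factorial_pos _
    have hy' : |y| ≤ R := by simpa using (mem_ball_zero_iff.1 hy).le
    simp only [hg', hu]
    rw [norm_mul, norm_div, norm_pow, norm_neg, norm_one, one_pow, norm_mul (j : ℝ), norm_pow,
      Real.norm_eq_abs, Real.norm_eq_abs, Real.norm_eq_abs, abs_of_pos (by positivity), Nat.abs_cast,
      div_mul_eq_mul_div, one_mul]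
    gcongr
    nlinarith

lemma besG_rec (m : ℕ) (t : ℝ) :
    t * besG (m+2) t - (m+1) * besG (m+1) t + besG m t = 0 := by
  have s0 := besG_summable m t
  have s1 := besG_summable (m+1) t
  have s2 := besG_summable (m+2) t
  have e0 : besG m t = ((-1 : ℝ) ^ 0 / ((0).factorial * (0 + m).factorial)) * t ^ 0 +
     ∑' j : ℕ, ((-1 : ℝ) ^ (j+1) / ((j+1).factorial * ((j+1) + m).factorial)) * t ^ (j+1) := by
    rw [besG, s0.tsum_eq_zero_add]
  have e1 : besG (m+1) t = ((-1 : ℝ) ^ 0 / ((0).factorial * (0 + (m+1)).factorial)) * t ^ 0 +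
     ∑' j : ℕ, ((-1 : ℝ) ^ (j+1) / ((j+1).factorial * ((j+1) + (m+1)).factorial)) * t ^ (j+1) := by
    rw [besG, s1.tsum_eq_zero_add]
  have s0' := (summable_nat_add_iff 1).2 s0
  have s1' := (summable_nat_add_iff 1).2 s1
  have e : t * besG (m+2) t - (m+1) * (∑' j : ℕ, ((-1 : ℝ) ^ (j+1) / ((j+1).factorial * ((j+1) + (m+1)).factorial)) * t ^ (j+1))
     + ∑' j : ℕ, ((-1 : ℝ) ^ (j+1) / ((j+1).factorial * ((j+1) + m).factorial)) * t ^ (j+1) = 0 := by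
    rw [besG, ← tsum_mul_left, ← tsum_mul_left, ← (s2.mul_left t).tsum_sub (s1'.mul_left _),
      ← ((s2.mul_left t).sub (s1'.mul_left _)).tsum_add s0']
    convert! tsum_zero with j
    have h0 : (j.factorial : ℝ) ≠ 0 := by exact_mod_cast Nat.factorial_ne_zero _
    have h1 : ((j + 1 + m).factorial : ℝ) ≠ 0 := by exact_mod_cast Nat.factorial_ne_zero _
    have h2 : (j:ℝ) + 1 ≠ 0 := by positivity
    have h3 : (j:ℝ) + 1 + m + 1 ≠ 0 := by positivity
    rw [show j + (m+2) = (j + 1 + m) + 1 by ring, show j + 1 + (m+1) = (j+1+m)+1 by ring,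
      Nat.factorial_succ j, Nat.factorial_succ (j+1+m)]
    push_cast
    field_simp
    ring
  rw [e0, e1, zero_add, zero_add, Nat.factorial_succ m]
  have h0 : (m.factorial : ℝ) ≠ 0 := by exact_mod_cast Nat.factorial_ne_zero _
  have h2 : (m:ℝ) + 1 ≠ 0 := by positivity
  rw [mul_add, ← sub_sub]
  have : ((m:ℝ) + 1) * ((-1) ^ 0 / (((0).factorial : ℝ) * (((m + 1) * m.factorial : ℕ):ℝ)) * t ^ 0) =
    (-1) ^ 0 / (((0).factorial : ℝ) * (m.factorial : ℝ)) * t ^ 0 := by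
    push_cast
    simp
    field_simp
  rw [this]
  linarith

lemma besG_zero_ne (m : ℕ) : besG m 0 ≠ 0 := by
  rw [besG, tsum_eq_single 0]
  · simp [Nat.factorial_ne_zero]
  · intro j hj
    simp [hj]

lemma besG_continuous (m : ℕ) : Continuous (besG m) :=
  continuous_iff_continuousAt.2 fun t => (besG_hasDerivAt m t).continuousAt

lemma besG_contDiff (m : ℕ) : ContDiff ℝ 2 (besG m) := by
  have hd : ∀ m, deriv (besG m) = fun t => - besG (m+1) t := fun m => by
    ext t; exact (besG_hasDerivAt m t).deriv
  have hD : ∀ m, Differentiable ℝ (besG m) := fun m t => (besG_hasDerivAt m t).differentiableAt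
  have h1 : ∀ m, ContDiff ℝ 1 (besG m) := fun m => by
    rw [contDiff_one_iff_deriv, hd]
    exact ⟨hD m, (besG_continuous _).neg⟩
  rw [show (2 : WithTop ℕ∞) = 1 + 1 by norm_num, contDiff_succ_iff_deriv, hd]
  refine ⟨hD m, by simp, (h1 _).neg⟩

lemma besselJ_eq (m : ℕ) (x : ℝ) : besselJ m x = (x/2)^m * besG m ((x/2)^2) := by
  rw [besselJ, besG, ← tsum_mul_left]
  congr 1; ext j
  rw [← pow_mul, pow_add]; ring

lemma pow_pred_mul {R : Type*} [CommRing R] (m : ℕ) (r : R) : r * ((m : R) * r ^ (m-1)) = m * r^m := by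
  cases m with
  | zero => simp
  | succ k => simp [pow_succ]; ring

lemma bessel_cond (m : ℕ) (η κ : ℝ) (hκ : 0 < κ) :
    (-(m : ℝ) * besselJ m κ + κ * deriv (besselJ m) κ - η * besselJ m κ = 0) ↔
    2 * (κ/2)^2 * besG (m+1) ((κ/2)^2) + η * besG m ((κ/2)^2) = 0 := by
  have hd : HasDerivAt (besselJ m) ((m * (κ/2)^(m-1) * (1/2)) * besG m ((κ/2)^2)
      + (κ/2)^m * (- besG (m+1) ((κ/2)^2) * (2 * (κ/2)^(2-1) * (1/2)))) κ := by
    rw [show besselJ m = fun x => (x/2)^m * besG m ((x/2)^2) from funext (besselJ_eq m)]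
    have h1 : HasDerivAt (fun x : ℝ => x/2) (1/2) κ := (hasDerivAt_id κ).div_const 2
    exact (h1.pow m).mul ((besG_hasDerivAt m _).comp κ (h1.pow 2))
  rw [hd.deriv, besselJ_eq]
  have hp := pow_pred_mul m (κ/2)
  have : -(m : ℝ) * ((κ/2)^m * besG m ((κ/2)^2)) + κ * ((m * (κ/2)^(m-1) * (1/2)) * besG m ((κ/2)^2)
      + (κ/2)^m * (- besG (m+1) ((κ/2)^2) * (2 * (κ/2)^(2-1) * (1/2)))) - η * ((κ/2)^m * besG m ((κ/2)^2))
      = - (κ/2)^m * (2 * (κ/2)^2 * besG (m+1) ((κ/2)^2) + η * besG m ((κ/2)^2)) := by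
    simp only [show 2 - 1 = 1 from rfl, pow_one]
    linear_combination besG m ((κ/2)^2) * hp
  rw [this, mul_eq_zero, or_iff_right]
  exact neg_ne_zero.2 (by positivity)

/-- Real radial mode. -/
def IsMode (c M : ℝ) (a a1 a2 : ℝ → ℝ) : Prop :=
  (∀ r, HasDerivAt a (a1 r) r) ∧ (∀ r, HasDerivAt a1 (a2 r) r) ∧
    ∀ r ∈ Set.Ico (0:ℝ) 1, r^2 * a2 r + r * a1 r + (4 * c * r^2 - M) * a r = 0

lemma deriv_zero_of_mono (f f' : ℝ → ℝ) (hf : ∀ r, HasDerivAt f (f' r) r)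
    (hp : ∀ r ∈ Set.Ioo (0:ℝ) 1, 0 ≤ f' r) (h0 : f 0 = 0) (h1 : f 1 = 0) :
    ∀ r ∈ Set.Ioo (0:ℝ) 1, f' r = 0 := by
  have hm : MonotoneOn f (Set.Icc 0 1) := by
    apply monotoneOn_of_deriv_nonneg (convex_Icc 0 1)
    · exact fun r _ => (hf r).continuousAt.continuousWithinAt
    · exact fun r _ => (hf r).differentiableAt.differentiableWithinAt
    · intro r hr
      rw [interior_Icc] at hr
      rw [(hf r).deriv]; exact hp r hr
  have hz : ∀ r ∈ Set.Icc (0:ℝ) 1, f r = 0 := fun r hr => by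
    have h2 := hm (Set.left_mem_Icc.2 zero_le_one) hr hr.1
    have h3 := hm hr (Set.right_mem_Icc.2 zero_le_one) hr.2
    linarith
  intro r hr
  have he : f =ᶠ[𝓝 r] fun _ => 0 := by
    filter_upwards [Ioo_mem_nhds hr.1 hr.2] with y hy
    exact hz y ⟨hy.1.le, hy.2.le⟩
  have := he.deriv_eq
  rw [(hf r).deriv] at this
  simpa using this

lemma zero_on_Icc (a : ℝ → ℝ) (ha : Continuous a) (h : ∀ r ∈ Set.Ioo (0:ℝ) 1, a r = 0) :
    ∀ r ∈ Set.Icc (0:ℝ) 1, a r = 0 := by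
  have h1 : Set.EqOn a (fun _ => 0) (Set.Ioo 0 1) := h
  have h2 := h1.closure ha continuous_const
  rw [closure_Ioo (by norm_num)] at h2
  exact h2

lemma IsMode.cont {c M : ℝ} {a a1 a2 : ℝ → ℝ} (h : IsMode c M a a1 a2) : Continuous a :=
  continuous_iff_continuousAt.2 fun r => (h.1 r).continuousAt

lemma IsMode.unique_pos {c M : ℝ} {a a1 a2 : ℝ → ℝ} (h : IsMode c M a a1 a2) (hc : 0 < c)
    (h0 : a 1 = 0) (h1 : a1 1 = 0) : ∀ r ∈ Set.Icc (0:ℝ) 1, a r = 0 := by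
  obtain ⟨ha, ha1, hode⟩ := id h
  apply zero_on_Icc a h.cont
  have hP : ∀ r, HasDerivAt (fun r => (r * a1 r)^2 + (4*c*r^2 - M) * (a r)^2)
      (2 * (r * a1 r) * (a1 r + r * a2 r) + (8 * c * r * (a r)^2 + (4*c*r^2 - M) * (2 * a r * a1 r))) r := by
    intro r
    have e1 := (((hasDerivAt_id r).mul (ha1 r)).pow 2)
    have e2 := ((((hasDerivAt_id r).pow 2).const_mul (4*c)).sub_const M).mul ((ha r).pow 2)
    convert! e1.add e2 using 1
    simp only [Pi.mul_apply, Pi.pow_apply, id, Nat.cast_ofNat, show 2 - 1 = 1 from rfl, pow_one]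
    ring
  have hP2 : ∀ r ∈ Set.Ioo (0:ℝ) 1, (2 * (r * a1 r) * (a1 r + r * a2 r) + (8 * c * r * (a r)^2 + (4*c*r^2 - M) * (2 * a r * a1 r))) = 8 * c * r * (a r)^2 := by
    intro r hr
    linear_combination 2 * a1 r * hode r ⟨hr.1.le, hr.2⟩
  have h00 := hode 0 (by simp)
  have := deriv_zero_of_mono _ _ hP (fun r hr => by
    rw [hP2 r hr]; have := hr.1; positivity) (by
      linear_combination (a 0) * h00) (by rw [h0, h1]; ring)
  intro r hr
  have h3 := this r hr
  rw [hP2 r hr] at h3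
  have h4 : 8 * c * r ≠ 0 := by have := hr.1; positivity
  simpa [h4, hc.ne', hr.1.ne'] using h3

lemma IsMode.unique_zero {M : ℝ} {a a1 a2 : ℝ → ℝ} (h : IsMode 0 M a a1 a2) (hM : 0 ≤ M)
    (h0 : a 1 = 0) : ∀ r ∈ Set.Icc (0:ℝ) 1, a r = 0 := by
  obtain ⟨ha, ha1, hode⟩ := id h
  have hP : ∀ r, HasDerivAt (fun r => r * (a r * a1 r))
      (a r * a1 r + r * (a1 r * a1 r + a r * a2 r)) r := by
    intro r
    convert! (hasDerivAt_id r).mul ((ha r).mul (ha1 r)) using 1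
    simp
  have hP2 : ∀ r ∈ Set.Ioo (0:ℝ) 1, r * (a r * a1 r + r * (a1 r * a1 r + a r * a2 r)) =
      (r * a1 r)^2 + M * (a r)^2 := by
    intro r hr
    linear_combination a r * hode r ⟨hr.1.le, hr.2⟩
  have := deriv_zero_of_mono _ _ hP (fun r hr => by
    have h2 := hP2 r hr
    have : 0 ≤ (r * a1 r)^2 + M * (a r)^2 := by positivity
    rw [← h2] at this
    exact nonneg_of_mul_nonneg_right this hr.1) (by simp) (by simp [h0])
  have hd : ∀ r ∈ Set.Ioo (0:ℝ) 1, a1 r = 0 := by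
    intro r hr
    have h3 := hP2 r hr
    rw [this r hr, mul_zero] at h3
    have h4 : 0 ≤ M * (a r)^2 := by positivity
    have h5 : (r * a1 r)^2 = 0 := le_antisymm (by linarith) (sq_nonneg _)
    simpa [hr.1.ne'] using h5
  intro r hr
  rcases eq_or_lt_of_le hr.2 with h' | h'
  · rw [h', h0]
  · obtain ⟨ξ, hξ, he⟩ := exists_hasDerivAt_eq_slope a a1 h' h.cont.continuousOn (fun x _ => ha x)
    rw [hd ξ ⟨lt_of_le_of_lt hr.1 hξ.1, hξ.2⟩, h0] at he
    have : (1 - r) ≠ 0 := by linarith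
    field_simp at he
    linarith

lemma IsMode.wronskian {c : ℝ} {m : ℕ} {a a1 a2 : ℝ → ℝ} (h : IsMode c ((m:ℝ)^2) a a1 a2) :
    a 1 * (m * besG m c - 2 * c * besG (m+1) c) = a1 1 * besG m c := by
  obtain ⟨ha, ha1, hode⟩ := id h
  have hs : ∀ r : ℝ, HasDerivAt (fun r : ℝ => c * r^2) (c * (2 * r)) r := fun r => by
    simpa using ((hasDerivAt_pow 2 r).const_mul c)
  have hG : ∀ l r, HasDerivAt (fun r => besG l (c * r^2)) (-besG (l+1) (c*r^2) * (c * (2*r))) r :=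
    fun l r => (besG_hasDerivAt l _).comp r (hs r)
  have hQ : ∀ r, HasDerivAt (fun r => a r * (r^m * (m * besG m (c*r^2) - 2 * (c * r^2) * besG (m+1) (c*r^2)))
      - (r * a1 r) * (r^m * besG m (c*r^2))) _ r := fun r =>
    ((ha r).mul ((hasDerivAt_pow m r).mul (((hG m r).const_mul (m:ℝ)).sub (((hs r).const_mul 2).mul (hG (m+1) r))))).sub
      (((hasDerivAt_id r).mul (ha1 r)).mul ((hasDerivAt_pow m r).mul (hG m r)))
  obtain ⟨ξ, hξ, he⟩ := exists_hasDerivAt_eq_slope _ _ zero_lt_one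
    (fun x _ => (hQ x).continuousAt.continuousWithinAt) (fun x _ => hQ x)
  have hr := besG_rec m (c * ξ^2)
  have hp := pow_pred_mul m ξ
  have ho := hode ξ ⟨hξ.1.le, hξ.2⟩
  simp only [Pi.mul_apply, Pi.sub_apply, id] at he
  have hz : a 0 * ((0:ℝ) ^ m * (↑m * besG m (c * 0 ^ 2) - 2 * (c * 0 ^ 2) * besG (m + 1) (c * 0 ^ 2))) = 0 := by
    rcases Nat.eq_zero_or_pos m with h | h
    · subst h; simp
    · simp [h.ne']
  rw [hz] at he
  simp only [one_pow, mul_one, one_mul, sub_zero, zero_mul, div_one] at he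
  have : ξ * (a 1 * (m * besG m c - 2 * c * besG (m+1) c) - a1 1 * besG m c) = 0 := by
    rw [← he]
    linear_combination (a ξ * (m * besG m (c*ξ^2) - 2 * (c*ξ^2) * besG (m+1) (c*ξ^2)) - ξ * a1 ξ * besG m (c*ξ^2)) * hp
      + 4 * (c*ξ^2) * ξ^m * a ξ * hr - ξ^m * besG m (c*ξ^2) * ho
  have h2 := (mul_eq_zero.1 this).resolve_left hξ.1.ne'
  linarith

lemma modes_zero {c η : ℝ} {m : ℕ} {a a1 a2 b b1 b2 : ℝ → ℝ} (hc : 0 < c)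
    (ha : IsMode c ((m:ℝ)^2) a a1 a2) (hb : IsMode 0 ((m:ℝ)^2) b b1 b2)
    (h1 : a 1 = b 1) (h2 : a1 1 - b1 1 = η * a 1)
    (hD : 2 * c * besG (m+1) c + η * besG m c ≠ 0) :
    ∀ r ∈ Set.Icc (0:ℝ) 1, a r = 0 ∧ b r = 0 := by
  have wa := ha.wronskian
  have wb := hb.wronskian
  have wb' : b1 1 = m * b 1 := by
    have := besG_zero_ne m
    apply mul_right_cancel₀ this
    linear_combination -wb
  have h3 : a 1 * (2 * c * besG (m+1) c + η * besG m c) = 0 := by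
    linear_combination -wa + (-h2 - wb' + m * h1) * besG m c
  have a0 := (mul_eq_zero.1 h3).resolve_right hD
  have b0 : b 1 = 0 := by rw [← h1, a0]
  have a10 : a1 1 = 0 := by rw [a0, wb', b0] at h2; linarith
  exact fun r hr => ⟨ha.unique_pos hc a0 a10 r hr, hb.unique_zero (by positivity) b0 r hr⟩

/-- radial unit vector -/
def uu (θ : ℝ) : EuclideanSpace ℝ (Fin 2) :=
  Real.cos θ • EuclideanSpace.single 0 1 + Real.sin θ • EuclideanSpace.single 1 1

/-- angular unit vector -/
def up (θ : ℝ) : EuclideanSpace ℝ (Fin 2) :=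
  -Real.sin θ • EuclideanSpace.single 0 1 + Real.cos θ • EuclideanSpace.single 1 1

lemma uu_deriv (θ : ℝ) : HasDerivAt uu (up θ) θ :=
  ((Real.hasDerivAt_cos θ).smul_const _).add ((Real.hasDerivAt_sin θ).smul_const _)

lemma up_deriv (θ : ℝ) : HasDerivAt up (-uu θ) θ := by
  have h := ((Real.hasDerivAt_sin θ).neg.smul_const (EuclideanSpace.single (0 : Fin 2) (1:ℝ))).add
    ((Real.hasDerivAt_cos θ).smul_const (EuclideanSpace.single (1 : Fin 2) (1:ℝ)))
  have e : -uu θ = -Real.cos θ • EuclideanSpace.single (0 : Fin 2) (1:ℝ)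
      + -Real.sin θ • EuclideanSpace.single (1 : Fin 2) (1:ℝ) := by
    rw [uu]; module
  rw [e]; exact h

lemma uu_cont : Continuous uu := continuous_iff_continuousAt.2 fun t => (uu_deriv t).continuousAt
lemma up_cont : Continuous up := continuous_iff_continuousAt.2 fun t => (up_deriv t).continuousAt

lemma uu_norm (θ : ℝ) : ‖uu θ‖ = 1 := by
  have : ‖uu θ‖^2 = 1 := by
    rw [EuclideanSpace.norm_sq_eq]
    simp [uu]
  nlinarith [norm_nonneg (uu θ)]

lemma hasDerivAt_param (F F' : ℝ → ℝ → ℂ) (hF : Continuous (Function.uncurry F))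
    (hF' : Continuous (Function.uncurry F')) (h : ∀ r θ, HasDerivAt (fun r => F r θ) (F' r θ) r)
    (T r : ℝ) : HasDerivAt (fun r => ∫ θ in (0:ℝ)..T, F r θ) (∫ θ in (0:ℝ)..T, F' r θ) r := by
  obtain ⟨C, hC⟩ := ((isCompact_closedBall r 1).prod (isCompact_uIcc (a := (0:ℝ)) (b := T))).exists_bound_of_continuousOn
    hF'.continuousOn
  have c1 : ∀ r, Continuous (F r) := fun r => hF.comp (by fun_prop : Continuous fun θ : ℝ => (r, θ))
  have c2 : ∀ r, Continuous (F' r) := fun r => hF'.comp (by fun_prop : Continuous fun θ : ℝ => (r, θ))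
  refine (intervalIntegral.hasDerivAt_integral_of_dominated_loc_of_deriv_le (bound := fun _ => C)
    (Metric.closedBall_mem_nhds r one_pos) (Eventually.of_forall fun r => (c1 r).aestronglyMeasurable)
    ((c1 r).intervalIntegrable _ _) (c2 r).aestronglyMeasurable ?_ intervalIntegrable_const ?_).2
  · refine Eventually.of_forall fun t ht x hx => ?_
    exact hC (x, t) ⟨hx, Set.uIoc_subset_uIcc ht⟩
  · exact Eventually.of_forall fun t _ x _ => h x t

/-- angular character -/
def ch (m : ℤ) (θ : ℝ) : ℂ := Complex.exp (-(m * θ * Complex.I))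

lemma ch_deriv (m : ℤ) (θ : ℝ) : HasDerivAt (ch m) (ch m θ * (-(m * Complex.I))) θ := by
  have : HasDerivAt (fun θ : ℝ => -(m * (θ:ℂ) * Complex.I)) (-(m * Complex.I)) θ := by
    have h := (((Complex.ofRealCLM.hasDerivAt (x := θ)).const_mul (m:ℂ)).mul_const Complex.I).neg
    simp only [Complex.ofRealCLM_apply, Complex.ofReal_one, mul_one] at h
    exact h
  exact this.cexp

lemma ch_cont (m : ℤ) : Continuous (ch m) := continuous_iff_continuousAt.2 fun t => (ch_deriv m t).continuousAt

section modes
variable (w : EuclideanSpace ℝ (Fin 2) → ℂ)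

def mA (m : ℤ) (r : ℝ) : ℂ := ∫ θ in (0:ℝ)..(2*Real.pi), ch m θ * w (r • uu θ)
def mA1 (m : ℤ) (r : ℝ) : ℂ := ∫ θ in (0:ℝ)..(2*Real.pi), ch m θ * fderiv ℝ w (r • uu θ) (uu θ)
def mA2 (m : ℤ) (r : ℝ) : ℂ :=
  ∫ θ in (0:ℝ)..(2*Real.pi), ch m θ * fderiv ℝ (fderiv ℝ w) (r • uu θ) (uu θ) (uu θ)

variable {w}

lemma c2_facts (hw : ContDiff ℝ 2 w) : Differentiable ℝ w ∧ Differentiable ℝ (fderiv ℝ w) ∧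
    Continuous (fderiv ℝ w) ∧ Continuous (fderiv ℝ (fderiv ℝ w)) := by
  have h1 : ContDiff ℝ 1 (fderiv ℝ w) := hw.fderiv_right (by norm_num)
  exact ⟨hw.differentiable (by norm_num), h1.differentiable (by norm_num), h1.continuous,
    h1.continuous_fderiv (by norm_num)⟩

lemma mA_deriv (hw : ContDiff ℝ 2 w) (m : ℤ) (r : ℝ) : HasDerivAt (mA w m) (mA1 w m r) r := by
  obtain ⟨d1, d2, c1, c2⟩ := c2_facts hw
  have hu := uu_cont
  have hch := ch_cont m
  have hw0 := hw.continuous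
  apply hasDerivAt_param (fun r θ => ch m θ * w (r • uu θ)) (fun r θ => ch m θ * fderiv ℝ w (r • uu θ) (uu θ))
  · simp only [Function.uncurry_def]; fun_prop
  · simp only [Function.uncurry_def]; fun_prop
  · intro r θ
    apply HasDerivAt.const_mul
    have : HasDerivAt (fun r : ℝ => r • uu θ) (uu θ) r := by
      simpa using (hasDerivAt_id r).smul_const (uu θ)
    exact (d1 _).hasFDerivAt.comp_hasDerivAt r this

lemma mA1_deriv (hw : ContDiff ℝ 2 w) (m : ℤ) (r : ℝ) : HasDerivAt (mA1 w m) (mA2 w m r) r := by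
  obtain ⟨d1, d2, c1, c2⟩ := c2_facts hw
  have hu := uu_cont
  have hch := ch_cont m
  apply hasDerivAt_param (fun r θ => ch m θ * fderiv ℝ w (r • uu θ) (uu θ))
    (fun r θ => ch m θ * fderiv ℝ (fderiv ℝ w) (r • uu θ) (uu θ) (uu θ))
  · simp only [Function.uncurry_def]; fun_prop
  · simp only [Function.uncurry_def]; fun_prop
  · intro r θ
    apply HasDerivAt.const_mul
    have : HasDerivAt (fun r : ℝ => r • uu θ) (uu θ) r := by
      simpa using (hasDerivAt_id r).smul_const (uu θ)
    have h2 := (d2 _).hasFDerivAt.comp_hasDerivAt r this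
    simpa using h2.clm_apply (hasDerivAt_const r (uu θ))

lemma lap_eq (hw : ContDiff ℝ 2 w) (x : EuclideanSpace ℝ (Fin 2)) (θ : ℝ) :
    lap w x = fderiv ℝ (fderiv ℝ w) x (uu θ) (uu θ) + fderiv ℝ (fderiv ℝ w) x (up θ) (up θ) := by
  obtain ⟨d1, d2, c1, c2⟩ := c2_facts hw
  have h : ∀ e : EuclideanSpace ℝ (Fin 2), fderiv ℝ (fun y => fderiv ℝ w y e) x e = fderiv ℝ (fderiv ℝ w) x e e := by
    intro e
    rw [fderiv_clm_apply (d2 x) (by fun_prop)]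
    simp
  simp only [lap, h, Fin.sum_univ_two, uu, up, map_add, map_smul, _root_.add_apply,
    _root_.smul_apply, Complex.real_smul]
  have hcs : (Real.cos θ : ℂ)^2 + (Real.sin θ : ℂ)^2 = 1 := by exact_mod_cast Real.cos_sq_add_sin_sq θ
  push_cast at *
  linear_combination (-fderiv ℝ (fderiv ℝ w) x (EuclideanSpace.single 0 1) (EuclideanSpace.single 0 1)
    - fderiv ℝ (fderiv ℝ w) x (EuclideanSpace.single 1 1) (EuclideanSpace.single 1 1)) * hcs

lemma mA_ode (hw : ContDiff ℝ 2 w) (m : ℤ) (r : ℝ) (c : ℝ)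
    (hl : ∀ θ, lap w (r • uu θ) + 4 * c * w (r • uu θ) = 0) :
    (r:ℂ)^2 * mA2 w m r + r * mA1 w m r + (4 * c * r^2 - (m:ℂ)^2) * mA w m r = 0 := by
  obtain ⟨d1, d2, c1, c2⟩ := c2_facts hw
  have hu := uu_cont
  have hup := up_cont
  have hch := ch_cont m
  have hw0 := hw.continuous
  have hu' : ∀ θ, HasDerivAt (fun θ => r • uu θ) (r • up θ) θ := fun θ => (uu_deriv θ).const_smul r
  have e1 : ∀ θ, HasDerivAt (fun θ => w (r • uu θ)) (fderiv ℝ w (r • uu θ) (r • up θ)) θ :=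
    fun θ => (d1 _).hasFDerivAt.comp_hasDerivAt θ (hu' θ)
  have e2 : ∀ θ, HasDerivAt (fun θ => fderiv ℝ w (r • uu θ) (r • up θ))
      (fderiv ℝ (fderiv ℝ w) (r • uu θ) (r • up θ) (r • up θ) + fderiv ℝ w (r • uu θ) (r • -uu θ)) θ :=
    fun θ => ((d2 _).hasFDerivAt.comp_hasDerivAt θ (hu' θ)).clm_apply ((up_deriv θ).const_smul r)
  have hH : ∀ θ, HasDerivAt (fun θ => ch m θ * (fderiv ℝ w (r • uu θ) (r • up θ) + m * Complex.I * w (r • uu θ)))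
      (-((r:ℂ)^2 * (ch m θ * fderiv ℝ (fderiv ℝ w) (r • uu θ) (uu θ) (uu θ))
        + r * (ch m θ * fderiv ℝ w (r • uu θ) (uu θ)) + (4 * c * r^2 - (m:ℂ)^2) * (ch m θ * w (r • uu θ)))) θ := by
    intro θ
    convert! (ch_deriv m θ).mul ((e2 θ).add ((e1 θ).const_mul (m * Complex.I))) using 1
    have h1 := hl θ
    rw [lap_eq hw _ θ] at h1
    simp only [map_smul, map_neg, _root_.smul_apply, Complex.real_smul, smul_neg, Pi.add_apply]
    linear_combination (-ch m θ * r^2) * h1 + (m:ℂ)^2 * ch m θ * w (r • uu θ) * Complex.I_sq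
  have hper : ch m (2*Real.pi) = ch m 0 := by
    simp only [ch]
    rw [Complex.ofReal_zero, mul_zero, zero_mul, neg_zero, Complex.exp_zero, Complex.exp_eq_one_iff]
    exact ⟨-m, by push_cast; ring⟩
  have hu2 : uu (2*Real.pi) = uu 0 := by simp [uu]
  have hp2 : up (2*Real.pi) = up 0 := by simp [up]
  have hi := intervalIntegral.integral_eq_sub_of_hasDerivAt (a := 0) (b := 2*Real.pi) (fun θ _ => hH θ)
    (Continuous.intervalIntegrable (by fun_prop) _ _)
  rw [hper, hu2, hp2, sub_self, intervalIntegral.integral_neg, neg_eq_zero,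
    intervalIntegral.integral_add (Continuous.intervalIntegrable (by fun_prop) _ _) (Continuous.intervalIntegrable (by fun_prop) _ _),
    intervalIntegral.integral_add (Continuous.intervalIntegrable (by fun_prop) _ _) (Continuous.intervalIntegrable (by fun_prop) _ _),
    intervalIntegral.integral_const_mul, intervalIntegral.integral_const_mul, intervalIntegral.integral_const_mul] at hi
  exact hi

lemma isMode_re (hw : ContDiff ℝ 2 w) (m : ℤ) (c : ℝ)
    (hl : ∀ x ∈ Metric.ball (0 : EuclideanSpace ℝ (Fin 2)) 1, lap w x + 4 * c * w x = 0) :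
    IsMode c ((m.natAbs:ℝ)^2) (fun r => (mA w m r).re) (fun r => (mA1 w m r).re) (fun r => (mA2 w m r).re)
    ∧ IsMode c ((m.natAbs:ℝ)^2) (fun r => (mA w m r).im) (fun r => (mA1 w m r).im) (fun r => (mA2 w m r).im) := by
  have ho : ∀ r ∈ Set.Ico (0:ℝ) 1, ((r^2 : ℝ):ℂ) * mA2 w m r + (r:ℂ) * mA1 w m r
      + ((4 * c * r^2 - (m.natAbs:ℝ)^2 : ℝ) : ℂ) * mA w m r = 0 := by
    intro r hr
    have := mA_ode hw m r c (fun θ => hl _ (by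
      rw [mem_ball_zero_iff, norm_smul, uu_norm, mul_one, Real.norm_eq_abs, abs_of_nonneg hr.1]
      exact hr.2))
    have hm : ((m.natAbs : ℝ))^2 = (m:ℝ)^2 := by
      rw [Nat.cast_natAbs, Int.cast_abs, sq_abs]
    rw [hm]
    push_cast
    exact this
  refine ⟨⟨fun r => ?_, fun r => ?_, fun r hr => ?_⟩, ⟨fun r => ?_, fun r => ?_, fun r hr => ?_⟩⟩
  · exact Complex.reCLM.hasFDerivAt.comp_hasDerivAt r (mA_deriv hw m r)
  · exact Complex.reCLM.hasFDerivAt.comp_hasDerivAt r (mA1_deriv hw m r)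
  · simpa only [Complex.add_re, Complex.re_ofReal_mul, Complex.zero_re] using congrArg Complex.re (ho r hr)
  · exact Complex.imCLM.hasFDerivAt.comp_hasDerivAt r (mA_deriv hw m r)
  · exact Complex.imCLM.hasFDerivAt.comp_hasDerivAt r (mA1_deriv hw m r)
  · simpa only [Complex.add_im, Complex.im_ofReal_mul, Complex.zero_im] using congrArg Complex.im (ho r hr)

lemma modes_fourier_zero (hw : Continuous w) (r : ℝ) (h : ∀ m : ℤ, mA w m r = 0) (θ : ℝ) : w (r • uu θ) = 0 := by
  have hp : Function.Periodic (fun θ => w (r • uu θ)) (2*Real.pi) := fun θ => by simp [uu]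
  have : Fact (0 < 2*Real.pi) := ⟨Real.two_pi_pos⟩
  have hc : Continuous (fun θ => w (r • uu θ)) := by have := uu_cont; fun_prop
  let f : C(AddCircle (2*Real.pi), ℂ) := ⟨hp.lift, continuous_coinduced_dom.mpr hc⟩
  have hf : ∀ n, fourierCoeff f n = 0 := by
    intro n
    rw [fourierCoeff_eq_intervalIntegral f n 0, zero_add]
    have := h n
    simp only [mA] at this
    rw [← this.symm.trans this]
    rw [smul_eq_zero]; right
    rw [← this]
    congr 1; ext x
    rw [fourier_coe_apply, smul_eq_mul]
    congr 1
    rw [ch]; congr 1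
    have : (Real.pi : ℂ) ≠ 0 := by exact_mod_cast Real.pi_ne_zero
    push_cast
    field_simp
  have hs : Summable (fourierCoeff f) := by
    rw [show fourierCoeff f = fun _ => 0 from funext hf]; exact summable_zero
  have h2 := has_pointwise_sum_fourier_series_of_summable hs (θ : AddCircle (2*Real.pi))
  simp only [hf, zero_smul] at h2
  exact h2.unique hasSum_zero

end modes

lemma exists_polar (x : EuclideanSpace ℝ (Fin 2)) : ∃ θ, x = ‖x‖ • uu θ := by
  let z : ℂ := ⟨x 0, x 1⟩
  have hn : ‖z‖ = ‖x‖ := by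
    rw [Complex.norm_eq_sqrt_sq_add_sq, EuclideanSpace.norm_eq]; simp [z]
  refine ⟨z.arg, ?_⟩
  rw [← hn]
  ext i
  fin_cases i
  · simp [uu, Complex.norm_mul_cos_arg, z]
  · simp [uu, Complex.norm_mul_sin_arg, z]

lemma nder_uu (w : EuclideanSpace ℝ (Fin 2) → ℂ) (x) : nder id w x = fderiv ℝ w x x := by
  have : x = x 0 • EuclideanSpace.single 0 1 + x 1 • EuclideanSpace.single 1 1 := by
    ext i; fin_cases i <;> simp
  conv_rhs => rw [this, map_add, map_smul, map_smul, ← this]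
  simp [nder, pd, Fin.sum_univ_two]

lemma forward (c η : ℝ) (hc : 0 < c) (w v : EuclideanSpace ℝ (Fin 2) → ℂ) (hw : ContDiff ℝ 2 w) (hv : ContDiff ℝ 2 v)
    (h1 : ∀ x ∈ Metric.ball (0 : EuclideanSpace ℝ (Fin 2)) 1, lap w x + 4 * c * w x = 0)
    (h2 : ∀ x ∈ Metric.ball (0 : EuclideanSpace ℝ (Fin 2)) 1, lap v x = 0)
    (h3 : ∀ x ∈ Metric.sphere (0 : EuclideanSpace ℝ (Fin 2)) 1, w x = v x)
    (h4 : ∀ x ∈ Metric.sphere (0 : EuclideanSpace ℝ (Fin 2)) 1,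
        nder id w x - nder id v x = (η : ℂ) * w x)
    (hD : ∀ m, 2 * c * besG (m+1) c + η * besG m c ≠ 0) :
    ∀ x ∈ Metric.ball (0 : EuclideanSpace ℝ (Fin 2)) 1, w x = 0 ∧ v x = 0 := by
  have hs : ∀ θ, uu θ ∈ Metric.sphere (0 : EuclideanSpace ℝ (Fin 2)) 1 := fun θ => by simp [uu_norm]
  have key : ∀ m : ℤ, ∀ r ∈ Set.Icc (0:ℝ) 1, mA w m r = 0 ∧ mA v m r = 0 := by
    intro m r hr
    have hu := uu_cont
    have hch := ch_cont m
    have mw := isMode_re hw m c h1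
    have mv := isMode_re hv m 0 (fun x hx => by simp [h2 x hx])
    have e1 : mA w m 1 = mA v m 1 := by
      simp only [mA, one_smul]
      congr 1; ext θ; rw [h3 _ (hs θ)]
    have e2 : mA1 w m 1 - mA1 v m 1 = η * mA w m 1 := by
      have := (c2_facts hw).2.2.1
      have := (c2_facts hv).2.2.1
      simp only [mA, mA1, one_smul]
      rw [← intervalIntegral.integral_const_mul, ← intervalIntegral.integral_sub (Continuous.intervalIntegrable (by fun_prop) _ _) (Continuous.intervalIntegrable (by fun_prop) _ _)]
      congr 1; ext θ
      have := h4 _ (hs θ)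
      rw [nder_uu, nder_uu] at this
      linear_combination ch m θ * this
    have r1 := modes_zero hc mw.1 mv.1 (congrArg Complex.re e1) (by simpa using congrArg Complex.re e2) (hD _) r hr
    have r2 := modes_zero hc mw.2 mv.2 (congrArg Complex.im e1) (by simpa using congrArg Complex.im e2) (hD _) r hr
    exact ⟨Complex.ext r1.1 r2.1, Complex.ext r1.2 r2.2⟩
  intro x hx
  obtain ⟨θ, hθ⟩ := exists_polar x
  have hr : ‖x‖ ∈ Set.Icc (0:ℝ) 1 := ⟨norm_nonneg x, (mem_ball_zero_iff.1 hx).le⟩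
  rw [hθ]
  exact ⟨modes_fourier_zero hw.continuous _ (fun m => (key m _ hr).1) θ, modes_fourier_zero hv.continuous _ (fun m => (key m _ hr).2) θ⟩

section converse

def zz (x : EuclideanSpace ℝ (Fin 2)) : ℂ := x 0 + x 1 * Complex.I
def ss (x : EuclideanSpace ℝ (Fin 2)) : ℝ := x 0 ^ 2 + x 1 ^ 2
def ze (i : Fin 2) : ℂ := if i = 0 then 1 else Complex.I

/-- `z^m G_m(c |z|²)` -/
def FF (m : ℕ) (c : ℝ) (x : EuclideanSpace ℝ (Fin 2)) : ℂ := zz x ^ m * (besG m (c * ss x) : ℝ)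

lemma zz_contDiff : ContDiff ℝ 2 zz := by
  have h : ∀ i : Fin 2, ContDiff ℝ 2 fun x : EuclideanSpace ℝ (Fin 2) => ((x i : ℝ) : ℂ) := fun i =>
    Complex.ofRealCLM.contDiff.comp (by fun_prop)
  exact (h 0).add ((h 1).mul contDiff_const)

lemma ss_contDiff : ContDiff ℝ 2 ss := by unfold ss; fun_prop

lemma FF_contDiff (m : ℕ) (c : ℝ) : ContDiff ℝ 2 (FF m c) :=
  (zz_contDiff.pow m).mul (Complex.ofRealCLM.contDiff.comp
    ((besG_contDiff m).comp (contDiff_const.mul ss_contDiff)))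

lemma line_xi (i j : Fin 2) (x : EuclideanSpace ℝ (Fin 2)) :
    HasDerivAt (fun t : ℝ => (x + t • EuclideanSpace.single i (1:ℝ)) j) (if j = i then 1 else 0) 0 := by
  have : HasDerivAt (fun t : ℝ => x j + t * (if j = i then 1 else 0)) (if j = i then 1 else 0) 0 := by
    simpa using ((hasDerivAt_id (0:ℝ)).mul_const (if j = i then (1:ℝ) else 0)).const_add (x j)
  convert! this using 2
  simp [Pi.single_apply]

lemma line_zz (i : Fin 2) (x : EuclideanSpace ℝ (Fin 2)) :
    HasDerivAt (fun t : ℝ => zz (x + t • EuclideanSpace.single i (1:ℝ))) (ze i) 0 := by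
  have := (line_xi i 0 x).ofReal_comp.add ((line_xi i 1 x).ofReal_comp.mul_const Complex.I)
  convert! this using 1
  fin_cases i <;> simp [ze]

lemma line_ss (i : Fin 2) (x : EuclideanSpace ℝ (Fin 2)) :
    HasDerivAt (fun t : ℝ => ss (x + t • EuclideanSpace.single i (1:ℝ))) (2 * x i) 0 := by
  have := ((line_xi i 0 x).pow 2).add ((line_xi i 1 x).pow 2)
  convert! this using 1
  fin_cases i <;> simp

lemma line_G (l : ℕ) (c : ℝ) (i : Fin 2) (x : EuclideanSpace ℝ (Fin 2)) :
    HasDerivAt (fun t : ℝ => ((besG l (c * ss (x + t • EuclideanSpace.single i (1:ℝ))) : ℝ) : ℂ))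
      (-(besG (l+1) (c * ss x) : ℝ) * (2 * c * x i)) 0 := by
  have h := ((besG_hasDerivAt l _).comp (0:ℝ) ((line_ss i x).const_mul c)).ofReal_comp
  convert! h using 1
  simp only [zero_smul, add_zero]
  push_cast
  ring

lemma line_pow (k : ℕ) (i : Fin 2) (x : EuclideanSpace ℝ (Fin 2)) :
    HasDerivAt (fun t : ℝ => zz (x + t • EuclideanSpace.single i (1:ℝ)) ^ k)
      (k * zz x ^ (k-1) * ze i) 0 := by
  have h := (line_zz i x).pow k
  simp only [zero_smul, add_zero] at h
  exact h

lemma FF_fderiv (m : ℕ) (c : ℝ) (i : Fin 2) (x : EuclideanSpace ℝ (Fin 2)) :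
    fderiv ℝ (FF m c) x (EuclideanSpace.single i 1) =
      (m * ze i) * (zz x ^ (m-1) * (besG m (c * ss x) : ℝ))
        - (2 * c) * ((x i : ℝ) * (zz x ^ m * (besG (m+1) (c * ss x) : ℝ))) := by
  rw [← ((FF_contDiff m c).differentiable (by norm_num) x).lineDeriv_eq_fderiv]
  have h := (line_pow m i x).mul (line_G m c i x)
  have h2 : HasLineDerivAt ℝ (FF m c) _ x (EuclideanSpace.single i 1) := h
  rw [h2.lineDeriv]
  simp only [zero_smul, add_zero]
  ring

lemma FF_lap (m : ℕ) (c : ℝ) (x : EuclideanSpace ℝ (Fin 2)) :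
    lap (FF m c) x + 4 * c * FF m c x = 0 := by
  obtain ⟨d1, d2, c1, c2⟩ := c2_facts (FF_contDiff m c)
  have hi : ∀ i, fderiv ℝ (fun y => fderiv ℝ (FF m c) y (EuclideanSpace.single i 1)) x (EuclideanSpace.single i 1)
    = (m * ze i) * (((m-1:ℕ):ℂ) * zz x ^ (m-1-1) * ze i * (besG m (c * ss x) : ℝ)
        + zz x ^ (m-1) * (-(besG (m+1) (c * ss x) : ℝ) * (2 * c * x i)))
      - (2 * c) * (1 * (zz x ^ m * (besG (m+1) (c * ss x) : ℝ)) +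
         (x i : ℝ) * (m * zz x ^ (m-1) * ze i * (besG (m+1) (c * ss x) : ℝ)
          + zz x ^ m * (-(besG (m+2) (c * ss x) : ℝ) * (2 * c * x i)))) := by
    intro i
    have hd : DifferentiableAt ℝ (fun y => fderiv ℝ (FF m c) y (EuclideanSpace.single i 1)) x := by fun_prop
    rw [← hd.lineDeriv_eq_fderiv]
    have h := (((line_pow (m-1) i x).mul (line_G m c i x)).const_mul (m * ze i)).sub
      (((line_xi i i x).ofReal_comp.mul ((line_pow m i x).mul (line_G (m+1) c i x))).const_mul (2 * (c:ℂ)))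
    have h1 : (fun y => fderiv ℝ (FF m c) y (EuclideanSpace.single i 1)) = fun y =>
      (m * ze i) * (zz y ^ (m-1) * (besG m (c * ss y) : ℝ))
        - (2 * c) * ((y i : ℝ) * (zz y ^ m * (besG (m+1) (c * ss y) : ℝ))) := funext fun y => FF_fderiv m c i y
    rw [h1]
    have h2 : HasLineDerivAt ℝ (fun y : EuclideanSpace ℝ (Fin 2) =>
      (m * ze i) * (zz y ^ (m-1) * (besG m (c * ss y) : ℝ))
        - (2 * c) * ((y i : ℝ) * (zz y ^ m * (besG (m+1) (c * ss y) : ℝ)))) _ x (EuclideanSpace.single i 1) := h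
    rw [h2.lineDeriv]
    simp only [zero_smul, add_zero, Pi.mul_apply, if_true, Complex.ofReal_one]
  have hr : ((c * ss x : ℝ) : ℂ) * (besG (m+2) (c * ss x) : ℝ) - (m+1) * (besG (m+1) (c * ss x) : ℝ) + (besG m (c * ss x) : ℝ) = 0 := by
    exact_mod_cast besG_rec m (c * ss x)
  have hp := pow_pred_mul m (zz x)
  simp only [lap, Fin.sum_univ_two, hi, FF]
  have z0 : ze 0 = 1 := rfl
  have z1 : ze 1 = Complex.I := rfl
  rw [z0, z1]
  have hz : zz x = x 0 + x 1 * Complex.I := rfl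
  have hs : ((c * ss x : ℝ) : ℂ) = c * ((x 0 : ℂ)^2 + (x 1 : ℂ)^2) := by simp [ss]
  rw [hs] at hr
  have hp' : (m:ℂ) * zz x ^ (m-1) * (x 0 + x 1 * Complex.I) = m * zz x ^ m := by
    rw [← hz, ← hp]; ring
  linear_combination (4 * c * zz x ^ m) * hr - 4 * c * (besG (m+1) (c * ss x) : ℝ) * hp'
    + m * (((m-1:ℕ):ℂ) * zz x ^ (m-1-1) * (besG m (c * ss x) : ℝ)) * Complex.I_sq

lemma FF_nder (m : ℕ) (c : ℝ) (x : EuclideanSpace ℝ (Fin 2)) (hx : ss x = 1) :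
    nder id (FF m c) x = zz x ^ m * (m * (besG m c : ℝ) - 2 * c * (besG (m+1) c : ℝ)) := by
  simp only [nder, pd, FF_fderiv, Fin.sum_univ_two, hx, mul_one, id, Complex.real_smul]
  have z0 : ze 0 = 1 := rfl
  have z1 : ze 1 = Complex.I := rfl
  rw [z0, z1]
  have hz : zz x = x 0 + x 1 * Complex.I := rfl
  have hs : (x 0 : ℂ)^2 + (x 1 : ℂ)^2 = 1 := by exact_mod_cast hx
  have hp := pow_pred_mul m (zz x)
  have hp' : (m:ℂ) * zz x ^ (m-1) * (x 0 + x 1 * Complex.I) = m * zz x ^ m := by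
    rw [← hz, ← hp]; ring
  linear_combination (besG m c : ℂ) * hp' - 2 * c * zz x ^ m * (besG (m+1) c : ℝ) * hs

lemma nder_mul (b : ℂ) (f : EuclideanSpace ℝ (Fin 2) → ℂ) (hf : ContDiff ℝ 2 f) (x) :
    nder id (fun y => b * f y) x = b * nder id f x := by
  rw [nder_uu, nder_uu, fderiv_const_mul ((hf.differentiable (by norm_num)) x)]
  simp

lemma lap_mul (b : ℂ) (f : EuclideanSpace ℝ (Fin 2) → ℂ) (hf : ContDiff ℝ 2 f) (x) :
    lap (fun y => b * f y) x = b * lap f x := by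
  have h1 := c2_facts hf
  have : fderiv ℝ (fun y => b * f y) = fun y => b • fderiv ℝ f y := by
    ext1 y; rw [fderiv_const_mul (h1.1 y)]
  rw [lap_eq (contDiff_const.mul hf) x 0, lap_eq hf x 0, this, fderiv_fun_const_smul (h1.2.1 x)]
  simp [mul_add]

lemma backward (c η : ℝ) (m : ℕ) (hD : 2 * c * besG (m+1) c + η * besG m c = 0) :
    ∃ w v : EuclideanSpace ℝ (Fin 2) → ℂ, ContDiff ℝ 2 w ∧ ContDiff ℝ 2 v ∧
      ¬ (∀ x ∈ Metric.ball (0 : EuclideanSpace ℝ (Fin 2)) 1, w x = 0 ∧ v x = 0) ∧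
      (∀ x ∈ Metric.ball (0 : EuclideanSpace ℝ (Fin 2)) 1,
        lap w x + 4 * c * w x = 0) ∧
      (∀ x ∈ Metric.ball (0 : EuclideanSpace ℝ (Fin 2)) 1, lap v x = 0) ∧
      (∀ x ∈ Metric.sphere (0 : EuclideanSpace ℝ (Fin 2)) 1, w x = v x) ∧
      (∀ x ∈ Metric.sphere (0 : EuclideanSpace ℝ (Fin 2)) 1,
        nder id w x - nder id v x = (η : ℂ) * w x) := by
  have hg0 : ((besG m 0 : ℝ) : ℂ) ≠ 0 := by exact_mod_cast besG_zero_ne m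
  have hss : ∀ x ∈ Metric.sphere (0 : EuclideanSpace ℝ (Fin 2)) 1, ss x = 1 := by
    intro x hx
    have h := EuclideanSpace.norm_sq_eq x
    rw [mem_sphere_zero_iff_norm.1 hx] at h
    simp [Fin.sum_univ_two] at h
    exact h.symm
  refine ⟨FF m c, fun x => ((besG m c : ℝ) / (besG m 0 : ℝ) : ℂ) * FF m 0 x, FF_contDiff m c,
    contDiff_const.mul (FF_contDiff m 0), ?_, fun x _ => FF_lap m c x, ?_, ?_, ?_⟩
  · intro hall
    have hev : ∀ᶠ t : ℝ in 𝓝[>] 0, besG m (c * t^2) ≠ 0 := by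
      have hc : Continuous fun t : ℝ => besG m (c * t^2) := (besG_continuous m).comp (by fun_prop)
      have := hc.continuousAt.eventually_ne (x := 0) (y := 0) (by simpa using besG_zero_ne m)
      exact this.filter_mono nhdsWithin_le_nhds
    have hev2 : ∀ᶠ t : ℝ in 𝓝[>] 0, t ∈ Set.Ioo (0:ℝ) 1 := Ioo_mem_nhdsGT one_pos
    obtain ⟨t, ht, ht2⟩ := (hev.and hev2).exists
    have h := (hall (t • EuclideanSpace.single 0 1) (by
      rw [mem_ball_zero_iff, norm_smul]
      simp [abs_of_pos ht2.1, ht2.2])).1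
    simp [FF, zz, ss] at h
    rcases h with h | h
    · exact ht2.1.ne' h.1
    · exact ht h
  · intro x _
    rw [lap_mul _ _ (FF_contDiff m 0)]
    have := FF_lap m 0 x
    simp only [Complex.ofReal_zero, mul_zero, zero_mul, add_zero] at this
    rw [this, mul_zero]
  · intro x hx
    simp only [FF, hss x hx, mul_one]
    field_simp
  · intro x hx
    rw [nder_mul _ _ (FF_contDiff m 0), FF_nder m c x (hss x hx), FF_nder m 0 x (hss x hx)]
    simp only [FF, hss x hx, mul_one]
    have hD' : 2 * (c:ℂ) * (besG (m+1) c : ℝ) + η * (besG m c : ℝ) = 0 := by exact_mod_cast hD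
    push_cast
    field_simp
    linear_combination -(zz x ^ m) * (besG m 0 : ℝ) * hD'

end converse

/-- for the unit disk, the zero-index (`ñ = 0`) conductive interior
transmission eigenvalue problem with constant `n > 0`, `η > 0` has eigenvalue `k > 0`
(there is a nontrivial pair `(w,v)` with `Δw + k²nw = 0`, `Δv = 0` in the disk,
`w = v` and `∂_r w − ∂_r v = ηw` on the unit circle) iff for some `m ≥ 0`:
`−m J_m(k√n) + k√n J_m'(k√n) − η J_m(k√n) = 0`. -/
theorem unit_disk_zero_index_determinant_condition (n η k : ℝ) (hn : 0 < n)
    (hη : 0 < η) (hk : 0 < k) :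
    (∃ w v : EuclideanSpace ℝ (Fin 2) → ℂ, ContDiff ℝ 2 w ∧ ContDiff ℝ 2 v ∧
      ¬ (∀ x ∈ Metric.ball (0 : EuclideanSpace ℝ (Fin 2)) 1, w x = 0 ∧ v x = 0) ∧
      (∀ x ∈ Metric.ball (0 : EuclideanSpace ℝ (Fin 2)) 1,
        lap w x + (k : ℂ) ^ 2 * (n : ℂ) * w x = 0) ∧
      (∀ x ∈ Metric.ball (0 : EuclideanSpace ℝ (Fin 2)) 1, lap v x = 0) ∧
      (∀ x ∈ Metric.sphere (0 : EuclideanSpace ℝ (Fin 2)) 1, w x = v x) ∧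
      (∀ x ∈ Metric.sphere (0 : EuclideanSpace ℝ (Fin 2)) 1,
        nder id w x - nder id v x = (η : ℂ) * w x)) ↔
    ∃ m : ℕ, -(m : ℝ) * besselJ m (k * Real.sqrt n)
      + k * Real.sqrt n * deriv (besselJ m) (k * Real.sqrt n)
      - η * besselJ m (k * Real.sqrt n) = 0 := by
  set κ := k * Real.sqrt n with hκ
  have hκ0 : 0 < κ := mul_pos hk (Real.sqrt_pos.2 hn)
  have hc : 0 < (κ/2)^2 := by positivity
  have h4c : 4 * (((κ/2)^2 : ℝ) : ℂ) = (k : ℂ)^2 * (n : ℂ) := by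
    have : 4 * (κ/2)^2 = k^2 * n := by
      rw [hκ, div_pow, mul_pow, Real.sq_sqrt hn.le]; ring
    exact_mod_cast congrArg ((↑) : ℝ → ℂ) this
  simp only [bessel_cond _ η κ hκ0, ← h4c]
  constructor
  · rintro ⟨w, v, hw, hv, hne, h1, h2, h3, h4⟩
    by_contra! hD
    exact hne (forward _ η hc w v hw hv h1 h2 h3 h4 hD)
  · rintro ⟨m, hm⟩
    exact backward _ η m hm

end
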